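/- Let x, z, w ∈ P, and let φ : *E_x → *E_z and ψ : *E_z → *E_w be degree-preserving S-homomorphisms. (1) If φ and ψ are clean, then the composition ψ ∘ φ is clean. (2) If ψ and ψ ∘ φ are clean and ψ ≠ 0, then φ is clean. -/

import Mathlib

open scoped Classical
open MvPolynomial

noncomputable section

variable (K : Type) [Field K]
variable (P : Type) [Fintype P] [PartialOrder P] [OrderBot P]

/-- A finite poset with a least element is *simplicial* if every lower interval
is isomorphic to a boolean algebra (the lattice of all subsets of a finite set). -/
def IsSimplicialPoset : Prop :=
  ∀ x : P, ∃ m : ℕ, Nonempty (Set.Iic x ≃o Finset (Fin m))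

/-- `P* := P \ {0̂}`. -/
abbrev Pstar := {z : P // z ≠ ⊥}

/-- The polynomial ring `S = K[t_z : z ∈ P*]`. -/
abbrev FaceS := MvPolynomial (Pstar P) K

/-- The variable `t_z`, with the convention `t_{0̂} = 1`. -/
def tvar (z : P) : FaceS K P := if h : z = ⊥ then 1 else X ⟨z, h⟩

/-- The set `[a ∨ b]` of minimal elements of the common upper bounds of `a` and `b`. -/
def minUB (a b : P) : Set P :=
  {z | a ≤ z ∧ b ≤ z ∧ ∀ w, a ≤ w → b ≤ w → ¬ w < z}

/-- Minimal elements of the common upper bounds of a set `A`. -/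
def minUBset (A : Set P) : Set P :=
  {z | (∀ a ∈ A, a ≤ z) ∧ ∀ w, (∀ a ∈ A, a ≤ w) → ¬ w < z}

/-- The meet `a ∧ b`, i.e. the largest common lower bound, when it exists (`⊥` otherwise). -/
def pmeet (a b : P) : P :=
  if h : ∃ m, m ≤ a ∧ m ≤ b ∧ ∀ w, w ≤ a → w ≤ b → w ≤ m then h.choose else ⊥

/-- The generator `f_{a,b} = t_a t_b - t_{a ∧ b} ∑_{z ∈ [a ∨ b]} t_z` of the face ideal. -/
def fgen (a b : Pstar P) : FaceS K P :=
  X a * X b - tvar K P (pmeet P a.1 b.1) *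
    ∑ z ∈ (Set.toFinite (minUB P a.1 b.1)).toFinset, tvar K P z

/-- The face ideal `I_P`. -/
def faceIdeal : Ideal (FaceS K P) :=
  Ideal.span (Set.range fun p : Pstar P × Pstar P => fgen K P p.1 p.2)

variable (n : ℕ) (y : Fin n → P)

/-- `y` is an enumeration of the rank one elements (= atoms) of `P`. -/
def AtomEnum : Prop :=
  Function.Injective y ∧ ∀ p : P, IsAtom p ↔ ∃ i, y i = p

/-- The rank of an element: the number of atoms below it. -/
def prank (z : P) : ℕ := (Finset.univ.filter fun i : Fin n => y i ≤ z).card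

/-- The `ℤⁿ`-degree of the variable `t_z`: `deg t_z = ∑_{y_i ≤ z} e_i`. -/
def tdeg (z : Pstar P) : Fin n → ℤ := fun i => if y i ≤ z.1 then 1 else 0

/-- `w = ∑_{z ∈ P*} deg t_z`. -/
def wvec : Fin n → ℤ := fun i => ∑ z : Pstar P, tdeg P n y z i

/-- The degree `d` homogeneous component of `S` for the `ℤⁿ`-grading. -/
def Sgrade (d : Fin n → ℤ) : AddSubgroup (FaceS K P) :=
  (weightedHomogeneousSubmodule K (tdeg P n y) d).toAddSubgroup

/-- The transformed variable `t̃_z` (relative to `x`), with `t̃_{0̂} = 1`. -/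
def ttil (x z : P) : FaceS K P :=
  if z ≤ x ∧ 2 ≤ prank P n y z then
    tvar K P z - ∏ i ∈ Finset.univ.filter fun i : Fin n => y i ≤ z, tvar K P (y i)
  else tvar K P z

/-- The graded prime ideal `p_x = (t_z : z ≰ x) + I_P`. -/
def pIdeal (x : P) : Ideal (FaceS K P) :=
  Ideal.span ((fun z : Pstar P => (X z : FaceS K P)) '' {z | ¬ z.1 ≤ x}) ⊔ faceIdeal K P

/-- The indices of the atoms below `x`. -/
abbrev BelowIx (x : P) := {i : Fin n // y i ≤ x}

/-- `P*_{-x}`: the elements of `P*` which are not atoms below `x`. -/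
abbrev Pmx (x : P) := {z : P // z ≠ ⊥ ∧ ¬ ∃ i : Fin n, y i ≤ x ∧ y i = z}

/-- Index monoid for the "big Laurent" model of `*E_x`. -/
abbrev EIdx (x : P) := (BelowIx P n y x →₀ ℤ) × (Pmx P n y x →₀ ℤ)

/-- The "big Laurent" algebra `K[t_i^{±1} : y_i ≤ x] ⊗_K K[t̃_z^{±1} : z ∈ P*_{-x}]`. -/
abbrev Gx (x : P) := AddMonoidAlgebra K (EIdx P n y x)

/-- Exponent vector of `π_x(t_z) = ∏_{y_i ≤ z} t_i`. -/
def dvec (x : P) (z : P) : BelowIx P n y x →₀ ℤ :=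
  Finsupp.equivFunOnFinite.symm fun i => if y i.1 ≤ z then 1 else 0

/-- The action of `S` on the big Laurent algebra through the comultiplication
`Δ(t_z) = t_z ⊗ 1 + 1 ⊗ t_z`:  the variable `t_z` acts as `π_x(t_z) ⊗ 1 + 1 ⊗ t_z`. -/
def theta (x : P) : FaceS K P →ₐ[K] Gx K P n y x :=
  aeval fun z : Pstar P =>
    (if z.1 ≤ x then AddMonoidAlgebra.single (dvec P n y x z.1, 0) 1 else 0) +
    (if h : ∃ i : Fin n, y i ≤ x ∧ y i = z.1 then 0
     else AddMonoidAlgebra.single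
       ((0 : BelowIx P n y x →₀ ℤ), Finsupp.single (⟨z.1, z.2, h⟩ : Pmx P n y x) (1 : ℤ)) 1)

instance gxModule (x : P) : Module (FaceS K P) (Gx K P n y x) :=
  Module.compHom _ (theta K P n y x).toRingHom

instance gxTower (x : P) : IsScalarTower K (FaceS K P) (Gx K P n y x) := by
  refine ⟨fun k s g => ?_⟩
  show theta K P n y x (k • s) * g = k • (theta K P n y x s * g)
  rw [map_smul, smul_mul_assoc]

instance gxComm (x : P) : SMulCommClass (FaceS K P) K (Gx K P n y x) := by
  refine ⟨fun s k g => ?_⟩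
  show theta K P n y x s * (k • g) = k • (theta K P n y x s * g)
  exact mul_smul_comm k _ g

/-- The submodule by which we quotient the big Laurent algebra to obtain `*E_x`. -/
def Ux (x : P) : Submodule (FaceS K P) (Gx K P n y x) :=
  Submodule.span (FaceS K P)
    {g | ∃ p : EIdx P n y x, (∃ w, 0 < p.2 w) ∧ g = AddMonoidAlgebra.single p 1}

/-- The `ℤⁿ`-graded `S`-module `*E_x = K[t_i^{±1} : y_i ≤ x] ⊗_K K[t_z^{-1} : z ∈ P*_{-x}]`. -/
abbrev ExMod (x : P) := Gx K P n y x ⧸ Ux K P n y x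

instance exComm (x : P) : SMulCommClass (FaceS K P) K (ExMod K P n y x) := by
  refine ⟨fun s k e => ?_⟩
  obtain ⟨g, rfl⟩ := Submodule.Quotient.mk_surjective _ e
  simp only [← Submodule.Quotient.mk_smul]
  rw [smul_comm]

def mIdx (x : P) (a : BelowIx P n y x →₀ ℤ) (b : Pmx P n y x →₀ ℕ) : EIdx P n y x :=
  (a, -Finsupp.mapRange (Nat.cast : ℕ → ℤ) Nat.cast_zero b)

/-- The monomial `∏ t_i^{a_i} ⊗ ∏ t_z^{-b_z}` of `*E_x`. -/
def emono (x : P) (a : BelowIx P n y x →₀ ℤ) (b : Pmx P n y x →₀ ℕ) : ExMod K P n y x :=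
  Submodule.Quotient.mk (AddMonoidAlgebra.single (mIdx P n y x a b) 1)

/-- `1_x = 1 ⊗ 1 ∈ *E_x`. -/
def onex (x : P) : ExMod K P n y x := emono K P n y x 0 0

/-- The `ℤⁿ`-degree of the monomial of `*E_x` with index `p`. -/
def gdeg (x : P) (p : EIdx P n y x) : Fin n → ℤ := fun i =>
  (if h : y i ≤ x then p.1 ⟨i, h⟩ else 0) +
    p.2.sum fun w c => c * (if y i ≤ w.1 then 1 else 0)

/-- The degree `aa` homogeneous component of `*E_x`. -/
def ExGrade (x : P) (aa : Fin n → ℤ) : Submodule K (ExMod K P n y x) :=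
  Submodule.span K
    {e | ∃ p : EIdx P n y x, gdeg P n y x p = aa ∧
      e = Submodule.Quotient.mk (AddMonoidAlgebra.single p 1)}

/-- `L(*E_x)`: the span of the basis monomials with nontrivial second factor and
componentwise nonnegative `ℤⁿ`-degree. -/
def cleanL (x : P) : Submodule K (ExMod K P n y x) :=
  Submodule.span K
    {e | ∃ a b, b ≠ 0 ∧ (∀ i, 0 ≤ gdeg P n y x (mIdx P n y x a b) i) ∧
      e = emono K P n y x a b}

/-- Degree preserving homomorphisms `*E_x → *E_z` (elements of `[*Hom(E_x, E_z)]_0`). -/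
def DegZero (x z : P) (φ : ExMod K P n y x →ₗ[FaceS K P] ExMod K P n y z) : Prop :=
  ∀ aa, ∀ e ∈ ExGrade K P n y x aa, φ e ∈ ExGrade K P n y z aa

/-- Clean homomorphisms `*E_x → *E_z`. -/
def IsClean (x z : P) (φ : ExMod K P n y x →ₗ[FaceS K P] ExMod K P n y z) : Prop :=
  DegZero K P n y x z φ ∧ ∀ e ∈ cleanL K P n y x, φ e ∈ cleanL K P n y z


theorem smul_gx (x : P) (s : FaceS K P) (g : Gx K P n y x) :
    s • g = theta K P n y x s * g := rfl

theorem coeff_single_mul_eq_zero (x : P) (r : EIdx P n y x) (c : K) (g : Gx K P n y x)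
    (hr : ∀ w, 0 ≤ r.2 w) (hg : ∀ q : EIdx P n y x, (∀ w, q.2 w ≤ 0) → g.coeff q = 0)
    (q : EIdx P n y x) (hq : ∀ w, q.2 w ≤ 0) :
    (AddMonoidAlgebra.single r c * g).coeff q = 0 := by
  rw [AddMonoidAlgebra.coeff_single_mul_apply, hg, mul_zero]
  intro w
  have h1 := hr w
  have h2 := hq w
  simp only [Prod.snd_add, Prod.snd_neg, Finsupp.coe_add, Finsupp.coe_neg, Pi.add_apply,
    Pi.neg_apply]
  omega

theorem coeff_theta_mul_eq_zero (x : P) (s : FaceS K P) (g : Gx K P n y x)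
    (hg : ∀ q : EIdx P n y x, (∀ w, q.2 w ≤ 0) → g.coeff q = 0) :
    ∀ q : EIdx P n y x, (∀ w, q.2 w ≤ 0) → (theta K P n y x s * g).coeff q = 0 := by
  induction s using MvPolynomial.induction_on generalizing g with
  | C a =>
    intro q hq
    rw [theta, aeval_C, ← Algebra.smul_def, AddMonoidAlgebra.coeff_smul_apply, hg q hq, smul_zero]
  | add s t hs ht =>
    intro q hq
    rw [map_add, add_mul, AddMonoidAlgebra.coeff_add, Finsupp.add_apply, hs g hg q hq,
      ht g hg q hq, add_zero]
  | mul_X s p hs =>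
    rw [map_mul, mul_assoc]
    refine hs _ fun q hq => ?_
    rw [theta, aeval_X, add_mul, AddMonoidAlgebra.coeff_add, Finsupp.add_apply]
    have h1 : ((if p.1 ≤ x then AddMonoidAlgebra.single (dvec P n y x p.1, 0) 1 else 0 :
        Gx K P n y x) * g).coeff q = 0 := by
      split_ifs with h
      · exact coeff_single_mul_eq_zero K P n y x _ _ g (fun w => le_rfl) hg q hq
      · simp
    rw [h1, zero_add]
    split_ifs with h
    · simp
    · refine coeff_single_mul_eq_zero K P n y x _ _ g (fun w => ?_) hg q hq
      simp only [Finsupp.single_apply]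
      split_ifs <;> simp

theorem single_mem_Ux (x : P) (p : EIdx P n y x) (c : K) (hp : ∃ w, 0 < p.2 w) :
    AddMonoidAlgebra.single p c ∈ Ux K P n y x := by
  have h : (AddMonoidAlgebra.single p c : Gx K P n y x)
      = c • AddMonoidAlgebra.single p 1 := by simp
  rw [h]
  exact Submodule.smul_of_tower_mem _ c (Submodule.subset_span ⟨p, hp, rfl⟩)

/-- The submodule `Ux` is spanned over `K` by the monomials with a positive exponent in the
second factor. -/
theorem mem_Ux_iff (x : P) (g : Gx K P n y x) :
    g ∈ Ux K P n y x ↔ ∀ q : EIdx P n y x, (∀ w, q.2 w ≤ 0) → g.coeff q = 0 := by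
  constructor
  · intro hg
    induction hg using Submodule.span_induction with
    | mem g hg =>
      obtain ⟨p, ⟨w, hw⟩, rfl⟩ := hg
      intro q hq
      rw [AddMonoidAlgebra.coeff_single, Finsupp.single_apply, if_neg]
      rintro rfl
      exact absurd (hq w) (not_le.2 hw)
    | zero => simp
    | add g h _ _ ihg ihh =>
      intro q hq
      rw [AddMonoidAlgebra.coeff_add, Finsupp.add_apply, ihg q hq, ihh q hq, add_zero]
    | smul s g _ ih => exact coeff_theta_mul_eq_zero K P n y x s g ih
  · intro hg
    rw [← AddMonoidAlgebra.sum_coeff_single g]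
    refine Submodule.sum_mem _ fun p hp => single_mem_Ux K P n y x p _ ?_
    by_contra! h
    exact Finsupp.mem_support_iff.1 hp (hg p h)

/-- The coefficient functional of `*E_x` at the basis monomial with index `q`. -/
def exCoeff (x : P) (q : EIdx P n y x) (hq : ∀ w, q.2 w ≤ 0) : ExMod K P n y x →+ K :=
  QuotientAddGroup.lift (Ux K P n y x).toAddSubgroup
    ((Finsupp.applyAddHom q).comp
      (AddMonoidAlgebra.coeffAddEquiv (R := K) (M := EIdx P n y x)).toAddMonoidHom)
    fun g hg => (mem_Ux_iff K P n y x g).1 hg q hq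

theorem exCoeff_mk (x : P) (q : EIdx P n y x) (hq : ∀ w, q.2 w ≤ 0) (g : Gx K P n y x) :
    exCoeff K P n y x q hq (Submodule.Quotient.mk g) = g.coeff q := rfl

theorem exCoeff_smul (x : P) (q : EIdx P n y x) (hq : ∀ w, q.2 w ≤ 0) (c : K)
    (e : ExMod K P n y x) :
    exCoeff K P n y x q hq (c • e) = c * exCoeff K P n y x q hq e := by
  obtain ⟨g, rfl⟩ := Submodule.Quotient.mk_surjective _ e
  rw [← Submodule.Quotient.mk_smul, exCoeff_mk, exCoeff_mk, AddMonoidAlgebra.coeff_smul_apply,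
    smul_eq_mul]

theorem exists_exCoeff_ne_zero (x : P) (e : ExMod K P n y x) (he : e ≠ 0) :
    ∃ q hq, exCoeff K P n y x q hq e ≠ 0 := by
  obtain ⟨g, rfl⟩ := Submodule.Quotient.mk_surjective _ e
  by_contra! h
  exact he ((Submodule.Quotient.mk_eq_zero _).2 ((mem_Ux_iff K P n y x g).2 h))

theorem exCoeff_theta_smul (x : P) (s : FaceS K P) (r : EIdx P n y x)
    (hs : theta K P n y x s = AddMonoidAlgebra.single r 1) (q : EIdx P n y x)
    (hq : ∀ w, q.2 w ≤ 0) (hq' : ∀ w, (r + q).2 w ≤ 0) (e : ExMod K P n y x) :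
    exCoeff K P n y x (r + q) hq' (s • e) = exCoeff K P n y x q hq e := by
  obtain ⟨g, rfl⟩ := Submodule.Quotient.mk_surjective _ e
  rw [← Submodule.Quotient.mk_smul, exCoeff_mk, exCoeff_mk, smul_gx, hs,
    AddMonoidAlgebra.coeff_single_mul_apply, one_mul, neg_add_cancel_left]

theorem smul_mk_single (x : P) (s : FaceS K P) (r p : EIdx P n y x) (c : K)
    (hs : theta K P n y x s = AddMonoidAlgebra.single r 1) :
    s • (Submodule.Quotient.mk (AddMonoidAlgebra.single p c) : ExMod K P n y x)
      = Submodule.Quotient.mk (AddMonoidAlgebra.single (r + p) c) := by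
  rw [← Submodule.Quotient.mk_smul, smul_gx, hs, AddMonoidAlgebra.single_mul_single, one_mul]

/-- Induction principle for `*E_x` along its (possibly vanishing) monomials. -/
theorem exMod_induction (x : P) {motive : ExMod K P n y x → Prop} (e : ExMod K P n y x)
    (zero : motive 0) (add : ∀ e f, motive e → motive f → motive (e + f))
    (single : ∀ p c, motive (Submodule.Quotient.mk (AddMonoidAlgebra.single p c))) :
    motive e := by
  obtain ⟨g, rfl⟩ := Submodule.Quotient.mk_surjective _ e
  induction g using AddMonoidAlgebra.induction_linear with
  | zero => exact zero
  | add g h hg hh => exact add _ _ hg hh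
  | single p c => exact single p c

/-- The monomial `∏ t_i ^ u_i` in the variables indexed by atoms. -/
def atomMono (u : Fin n → ℕ) : FaceS K P := ∏ i, tvar K P (y i) ^ u i

/-- The restriction of an exponent vector to the atoms below `x`. -/
def resExp (x : P) (d : Fin n → ℤ) : BelowIx P n y x →₀ ℤ :=
  Finsupp.equivFunOnFinite.symm fun i => d i.1

@[simp]
theorem resExp_apply (x : P) (d : Fin n → ℤ) (i : BelowIx P n y x) :
    resExp P n y x d i = d i.1 := rfl

variable {P n y} in
theorem AtomEnum.ne_bot (hy : AtomEnum P n y) (i : Fin n) : y i ≠ ⊥ :=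
  ((hy.2 (y i)).2 ⟨i, rfl⟩).1

variable {P n y} in
theorem AtomEnum.le_iff (hy : AtomEnum P n y) (i j : Fin n) : y i ≤ y j ↔ i = j := by
  refine ⟨fun h => ?_, fun h => h ▸ le_rfl⟩
  exact hy.1 ((((hy.2 (y j)).2 ⟨j, rfl⟩).le_iff.1 h).resolve_left (hy.ne_bot i))

theorem theta_atom (hy : AtomEnum P n y) (x : P) (i : Fin n) (hi : y i ≤ x) :
    theta K P n y x (tvar K P (y i)) =
      AddMonoidAlgebra.single (resExp P n y x (Pi.single i 1), 0) 1 := by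
  rw [tvar, dif_neg (hy.ne_bot i), theta, aeval_X, if_pos hi, dif_pos ⟨i, hi, rfl⟩, add_zero]
  congr 2
  ext j
  simp [dvec, resExp, hy.le_iff, Pi.single_apply]

theorem theta_atom_of_not_le (hy : AtomEnum P n y) (x : P) (i : Fin n) (hi : ¬ y i ≤ x) :
    ∃ v : Pmx P n y x, theta K P n y x (tvar K P (y i)) =
      AddMonoidAlgebra.single (0, Finsupp.single v 1) 1 := by
  have h : ¬ ∃ j : Fin n, y j ≤ x ∧ y j = y i := by
    rintro ⟨j, hj, hji⟩
    exact hi (hji ▸ hj)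
  refine ⟨⟨y i, hy.ne_bot i, h⟩, ?_⟩
  rw [tvar, dif_neg (hy.ne_bot i), theta, aeval_X, if_neg hi, dif_neg h, zero_add]

theorem theta_atomMono (hy : AtomEnum P n y) (x : P) (u : Fin n → ℕ)
    (hu : ∀ i, u i ≠ 0 → y i ≤ x) :
    theta K P n y x (atomMono K P n y u) =
      AddMonoidAlgebra.single (resExp P n y x fun i => u i, 0) 1 := by
  have h : ∀ i, theta K P n y x (tvar K P (y i)) ^ u i =
      AddMonoidAlgebra.single (u i • (resExp P n y x (Pi.single i 1), 0)) 1 := by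
    intro i
    by_cases hi : u i = 0
    · simp [hi, AddMonoidAlgebra.one_def]
    · rw [theta_atom K P n y hy x i (hu i hi), AddMonoidAlgebra.single_pow, one_pow]
  rw [atomMono, map_prod]
  simp_rw [map_pow, h]
  rw [AddMonoidAlgebra.prod_single, Finset.prod_const_one]
  congr 1
  ext j
  · simp [Prod.fst_sum, Finsupp.finsetSum_apply, Pi.single_apply]
  · simp [Prod.snd_sum]

/-- Every second-factor monomial `1 ⊗ ∏ t_z ^ b_z` is in the image of `S`. -/
theorem exists_theta_eq_single (hy : AtomEnum P n y) (x : P) (b : Pmx P n y x → ℕ) :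
    ∃ s, theta K P n y x s =
      AddMonoidAlgebra.single (0, Finsupp.equivFunOnFinite.symm fun v => (b v : ℤ)) 1 := by
  have h : ∀ v : Pmx P n y x, ∃ s, theta K P n y x s =
      AddMonoidAlgebra.single (0, Finsupp.single v 1) 1 := by
    intro v
    have hv : theta K P n y x (X ⟨v.1, v.2.1⟩) =
        (if v.1 ≤ x then AddMonoidAlgebra.single (dvec P n y x v.1, 0) 1 else 0) +
          AddMonoidAlgebra.single (0, Finsupp.single v 1) 1 := by
      rw [theta, aeval_X, dif_neg v.2.2]
    by_cases hx : v.1 ≤ x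
    · refine ⟨X ⟨v.1, v.2.1⟩ - atomMono K P n y fun i => if y i ≤ v.1 then 1 else 0, ?_⟩
      rw [map_sub, hv, if_pos hx, theta_atomMono K P n y hy x, sub_eq_iff_eq_add']
      · congr 3
        ext i
        simp [dvec]
      · intro i hi
        simp only [ne_eq, ite_eq_right_iff, one_ne_zero, imp_false, not_not] at hi
        exact hi.trans hx
    · exact ⟨X ⟨v.1, v.2.1⟩, by rw [hv, if_neg hx, zero_add]⟩
  choose s hs using h
  refine ⟨∏ v, s v ^ b v, ?_⟩
  simp_rw [map_prod, map_pow, hs, AddMonoidAlgebra.single_pow, one_pow]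
  rw [AddMonoidAlgebra.prod_single, Finset.prod_const_one]
  congr 1
  ext j
  · simp [Prod.fst_sum]
  · simp [Prod.snd_sum, Finsupp.finsetSum_apply, Finsupp.single_apply]

theorem exists_atomMono_smul_eq (hy : AtomEnum P n y) (x : P) (u : Fin n → ℕ)
    (hu : ∀ i, u i ≠ 0 → y i ≤ x) (e : ExMod K P n y x) :
    ∃ f, atomMono K P n y u • f = e := by
  obtain ⟨g, rfl⟩ := Submodule.Quotient.mk_surjective _ e
  refine ⟨Submodule.Quotient.mk
    (AddMonoidAlgebra.single (-(resExp P n y x fun i => u i, 0)) 1 * g), ?_⟩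
  rw [← Submodule.Quotient.mk_smul, smul_gx, theta_atomMono K P n y hy x u hu, ← mul_assoc,
    AddMonoidAlgebra.single_mul_single, add_neg_cancel, one_mul, ← AddMonoidAlgebra.one_def,
    one_mul]

theorem eq_zero_of_atom_smul_eq_zero (hy : AtomEnum P n y) (x : P) (i : Fin n) (hi : y i ≤ x)
    (e : ExMod K P n y x) (he : tvar K P (y i) • e = 0) : e = 0 := by
  by_contra h
  obtain ⟨q, hq, hne⟩ := exists_exCoeff_ne_zero K P n y x e h
  have hq' : ∀ w, ((resExp P n y x (Pi.single i 1), 0) + q : EIdx P n y x).2 w ≤ 0 := by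
    simpa using hq
  have := exCoeff_theta_smul K P n y x _ _ (theta_atom K P n y hy x i hi) q hq hq' e
  rw [he, map_zero] at this
  exact hne this.symm

theorem exists_atom_pow_smul_eq_zero (hy : AtomEnum P n y) (x : P) (i : Fin n)
    (hi : ¬ y i ≤ x) (e : ExMod K P n y x) : ∃ N : ℕ, tvar K P (y i) ^ N • e = 0 := by
  obtain ⟨v, hv⟩ := theta_atom_of_not_le K P n y hy x i hi
  induction e using exMod_induction with
  | zero => exact ⟨0, smul_zero _⟩
  | add e f he hf =>
    obtain ⟨M, hM⟩ := he
    obtain ⟨N, hN⟩ := hf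
    refine ⟨M + N, ?_⟩
    rw [smul_add, pow_add, mul_smul, mul_smul, hN, smul_comm, hM, smul_zero, smul_zero, add_zero]
  | single p c =>
    refine ⟨(1 - p.2 v).toNat, ?_⟩
    have h : theta K P n y x (tvar K P (y i) ^ (1 - p.2 v).toNat) = AddMonoidAlgebra.single
        ((1 - p.2 v).toNat • ((0 : BelowIx P n y x →₀ ℤ), Finsupp.single v (1 : ℤ))) 1 := by
      rw [map_pow, hv, AddMonoidAlgebra.single_pow, one_pow]
    rw [smul_mk_single K P n y x _ _ p c h]
    refine (Submodule.Quotient.mk_eq_zero _).2 (single_mem_Ux K P n y x _ c ⟨v, ?_⟩)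
    simp only [Prod.smul_mk, Prod.snd_add, Finsupp.coe_add, Pi.add_apply, Finsupp.smul_apply,
      Finsupp.single_eq_same, nsmul_eq_mul, mul_one]
    omega

/-- A nonzero homomorphism `*E_x → *E_z` forces the atoms below `z` to lie below `x`. -/
theorem atom_le_of_ne_zero (hy : AtomEnum P n y) (x z : P)
    (φ : ExMod K P n y x →ₗ[FaceS K P] ExMod K P n y z) (hφ : φ ≠ 0) (i : Fin n)
    (hi : y i ≤ z) : y i ≤ x := by
  by_contra hx
  refine hφ (LinearMap.ext fun e => ?_)
  obtain ⟨N, hN⟩ := exists_atom_pow_smul_eq_zero K P n y hy x i hx e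
  have h : tvar K P (y i) ^ N • φ e = 0 := by rw [← map_smul, hN, map_zero]
  rw [LinearMap.zero_apply]
  clear hN
  induction N with
  | zero => simpa using h
  | succ N ih =>
    rw [pow_succ', mul_smul] at h
    exact ih (eq_zero_of_atom_smul_eq_zero K P n y hy z i hi _ h)

theorem exCoeff_zero_of_mem_cleanL (x : P) (e : ExMod K P n y x) (he : e ∈ cleanL K P n y x) :
    exCoeff K P n y x 0 (fun _ => le_rfl) e = 0 := by
  induction he using Submodule.span_induction with
  | mem e he =>
    obtain ⟨a, b, hb, -, rfl⟩ := he
    rw [emono, exCoeff_mk, AddMonoidAlgebra.coeff_single, Finsupp.single_apply, if_neg]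
    intro h
    apply hb
    ext v
    have := DFunLike.congr_fun (congrArg Prod.snd h) v
    simpa [mIdx] using this
  | zero => exact map_zero _
  | add e f _ _ he hf => rw [map_add, he, hf, add_zero]
  | smul c e _ he => rw [exCoeff_smul, he, mul_zero]

theorem exCoeff_zero_of_mem_exGrade (x : P) (d : Fin n → ℤ) (hd : d ≠ 0) (e : ExMod K P n y x)
    (he : e ∈ ExGrade K P n y x d) : exCoeff K P n y x 0 (fun _ => le_rfl) e = 0 := by
  induction he using Submodule.span_induction with
  | mem e he =>
    obtain ⟨p, hp, rfl⟩ := he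
    rw [exCoeff_mk, AddMonoidAlgebra.coeff_single, Finsupp.single_apply, if_neg]
    rintro rfl
    apply hd
    rw [← hp]
    ext i
    simp [gdeg]
  | zero => exact map_zero _
  | add e f _ _ he hf => rw [map_add, he, hf, add_zero]
  | smul c e _ he => rw [exCoeff_smul, he, mul_zero]

theorem emono_mem_cleanL (x : P) (a : BelowIx P n y x →₀ ℤ) (b : Pmx P n y x →₀ ℕ)
    (hb : b ≠ 0) (hd : ∀ i, 0 ≤ gdeg P n y x (mIdx P n y x a b) i) :
    emono K P n y x a b ∈ cleanL K P n y x :=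
  Submodule.subset_span ⟨a, b, hb, hd, rfl⟩

/-- A homogeneous element of nonnegative degree `d` is congruent modulo `L(*E_x)` to a multiple
of the first-factor monomial of degree `d`. -/
theorem exists_sub_smul_mem_cleanL (x : P) (d : Fin n → ℤ) (hd : ∀ i, 0 ≤ d i)
    (e : ExMod K P n y x) (he : e ∈ ExGrade K P n y x d) :
    ∃ c : K, e - c • emono K P n y x (resExp P n y x d) 0 ∈ cleanL K P n y x := by
  induction he using Submodule.span_induction with
  | mem e he =>
    obtain ⟨p, hp, rfl⟩ := he
    by_cases hpos : ∃ v, 0 < p.2 v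
    · refine ⟨0, ?_⟩
      rw [(Submodule.Quotient.mk_eq_zero _).2 (single_mem_Ux K P n y x p 1 hpos), zero_smul,
        sub_zero]
      exact zero_mem _
    · push Not at hpos
      let b : Pmx P n y x →₀ ℕ := Finsupp.equivFunOnFinite.symm fun v => (-p.2 v).toNat
      have hpb : p = mIdx P n y x p.1 b := by
        refine Prod.ext rfl ?_
        ext v
        have := hpos v
        simp [mIdx, b]
        omega
      by_cases hb : b = 0
      · refine ⟨1, ?_⟩
        have ha : p.1 = resExp P n y x d := by
          ext i
          rw [hb] at hpb
          rw [resExp_apply, ← hp, hpb]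
          simp [gdeg, mIdx, i.2]
        have : p = mIdx P n y x (resExp P n y x d) 0 := by rw [← ha, ← hb]; exact hpb
        rw [this, one_smul, emono, sub_self]
        exact zero_mem _
      · refine ⟨0, ?_⟩
        rw [zero_smul, sub_zero, hpb]
        refine emono_mem_cleanL K P n y x p.1 b hb fun i => ?_
        rw [← hpb, hp]
        exact hd i
  | zero => exact ⟨0, by simp⟩
  | add e f _ _ he hf =>
    obtain ⟨c, hc⟩ := he
    obtain ⟨c', hc'⟩ := hf
    refine ⟨c + c', ?_⟩
    rw [add_smul, add_sub_add_comm]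
    exact add_mem hc hc'
  | smul k e _ he =>
    obtain ⟨c, hc⟩ := he
    refine ⟨k * c, ?_⟩
    rw [mul_smul, ← smul_sub]
    exact Submodule.smul_mem _ k hc

theorem gdeg_add (x : P) (p q : EIdx P n y x) :
    gdeg P n y x (p + q) = gdeg P n y x p + gdeg P n y x q := by
  ext i
  simp only [gdeg, Pi.add_apply, Prod.fst_add, Prod.snd_add]
  rw [Finsupp.sum_add_index' (by simp) (by intros; ring)]
  split_ifs
  · simp only [Finsupp.add_apply]; ring
  · ring

theorem gdeg_resExp (x : P) (d : Fin n → ℤ) (i : Fin n) :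
    gdeg P n y x (resExp P n y x d, 0) i = if y i ≤ x then d i else 0 := by
  simp [gdeg]

theorem atomMono_smul_emono (hy : AtomEnum P n y) (x : P) (u : Fin n → ℕ)
    (hu : ∀ i, u i ≠ 0 → y i ≤ x) (a : BelowIx P n y x →₀ ℤ) (b : Pmx P n y x →₀ ℕ) :
    atomMono K P n y u • emono K P n y x a b =
      emono K P n y x (resExp P n y x (fun i => u i) + a) b := by
  rw [emono, smul_mk_single K P n y x _ _ _ _ (theta_atomMono K P n y hy x u hu)]
  simp [emono, mIdx]

theorem atomMono_smul_mem_cleanL (hy : AtomEnum P n y) (x : P) (u : Fin n → ℕ)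
    (hu : ∀ i, u i ≠ 0 → y i ≤ x) (e : ExMod K P n y x) (he : e ∈ cleanL K P n y x) :
    atomMono K P n y u • e ∈ cleanL K P n y x := by
  induction he using Submodule.span_induction with
  | mem e he =>
    obtain ⟨a, b, hb, hd, rfl⟩ := he
    rw [atomMono_smul_emono K P n y hy x u hu]
    refine emono_mem_cleanL K P n y x _ b hb fun i => ?_
    have : mIdx P n y x (resExp P n y x (fun i => u i) + a) b =
        (resExp P n y x (fun i => u i), 0) + mIdx P n y x a b := by simp [mIdx]
    rw [this, gdeg_add, Pi.add_apply, gdeg_resExp]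
    refine add_nonneg ?_ (hd i)
    split_ifs <;> simp
  | zero => rw [smul_zero]; exact zero_mem _
  | add e f _ _ he hf => rw [smul_add]; exact add_mem he hf
  | smul c e _ he => rw [smul_comm]; exact Submodule.smul_mem _ c he

theorem map_smul_field (x z : P) (φ : ExMod K P n y x →ₗ[FaceS K P] ExMod K P n y z) (c : K)
    (e : ExMod K P n y x) : φ (c • e) = c • φ e :=
  LinearMap.map_smul_of_tower φ c e

theorem mk_single_mem_exGrade (x : P) (p : EIdx P n y x) (c : K) :
    (Submodule.Quotient.mk (AddMonoidAlgebra.single p c) : ExMod K P n y x) ∈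
      ExGrade K P n y x (gdeg P n y x p) := by
  have : (AddMonoidAlgebra.single p c : Gx K P n y x) = c • AddMonoidAlgebra.single p 1 := by
    simp
  rw [this, Submodule.Quotient.mk_smul]
  exact Submodule.smul_mem _ c (Submodule.subset_span ⟨p, rfl, rfl⟩)

/-- A degree-preserving homomorphism whose image has no component at `1_w` vanishes. -/
theorem eq_zero_of_exCoeff_zero (hy : AtomEnum P n y) (z w : P)
    (ψ : ExMod K P n y z →ₗ[FaceS K P] ExMod K P n y w)
    (hψ : ∀ e, exCoeff K P n y w 0 (fun _ => le_rfl) (ψ e) = 0) : ψ = 0 := by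
  by_contra hne
  have hwz := atom_le_of_ne_zero K P n y hy z w ψ hne
  obtain ⟨f, hf⟩ : ∃ f, ψ f ≠ 0 := by
    by_contra! h
    exact hne (LinearMap.ext h)
  obtain ⟨q, hq, hfq⟩ := exists_exCoeff_ne_zero K P n y w _ hf
  have hext : ∀ g : BelowIx P n y w → ℕ,
      ∃ u : Fin n → ℕ, (∀ i, u i ≠ 0 → y i ≤ w) ∧ ∀ i : BelowIx P n y w, u i.1 = g i := by
    intro g
    refine ⟨fun i => if h : y i ≤ w then g ⟨i, h⟩ else 0, fun i hi => ?_, fun i => dif_pos i.2⟩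
    by_contra h
    exact hi (dif_neg h)
  obtain ⟨u, huw, hu⟩ := hext fun i => (-q.1 i).toNat
  obtain ⟨v, hvw, hv⟩ := hext fun i => (q.1 i).toNat
  obtain ⟨s, hs⟩ := exists_theta_eq_single K P n y hy w fun v => (-q.2 v).toNat
  have hsu : theta K P n y w (atomMono K P n y u * s) =
      AddMonoidAlgebra.single (resExp P n y w (fun i => u i),
        Finsupp.equivFunOnFinite.symm fun v => ((-q.2 v).toNat : ℤ)) 1 := by
    rw [map_mul, hs, theta_atomMono K P n y hy w u huw,
      AddMonoidAlgebra.single_mul_single, one_mul, Prod.mk_add_mk, zero_add, add_zero]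
  have hsum : (resExp P n y w (fun i => u i),
        Finsupp.equivFunOnFinite.symm fun v => ((-q.2 v).toNat : ℤ)) + q =
      ((resExp P n y w (fun i => v i), 0) + 0 : EIdx P n y w) := by
    refine Prod.ext ?_ ?_
    · ext i
      simp [hu, hv]
      omega
    · ext j
      have := hq j
      simp
      omega
  obtain ⟨f', hf'⟩ := exists_atomMono_smul_eq K P n y hy z v
    (fun i hi => hwz i (hvw i hi)) ((atomMono K P n y u * s) • f)
  apply hfq
  rw [← exCoeff_theta_smul K P n y w _ _ hsu q hq (by rw [hsum]; exact fun _ => le_rfl),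
    ← map_smul, ← hf', map_smul, ← hψ f']
  simp_rw [hsum]
  exact exCoeff_theta_smul K P n y w _ _ (theta_atomMono K P n y hy w v hvw) _ _ _ _

theorem eq_zero_of_isClean_of_map_onex_mem (hy : AtomEnum P n y) (z w : P)
    (ψ : ExMod K P n y z →ₗ[FaceS K P] ExMod K P n y w) (hψ : IsClean K P n y z w ψ)
    (h1 : ψ (onex K P n y z) ∈ cleanL K P n y w) : ψ = 0 := by
  rw [onex] at h1
  refine eq_zero_of_exCoeff_zero K P n y hy z w ψ fun e => ?_
  induction e using exMod_induction with
  | zero => rw [map_zero, map_zero]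
  | add e f he hf => rw [map_add, map_add, he, hf, add_zero]
  | single p c =>
    have hp := mk_single_mem_exGrade K P n y z p c
    by_cases hd : gdeg P n y z p = 0
    · rw [hd] at hp
      obtain ⟨k, hk⟩ := exists_sub_smul_mem_cleanL K P n y z 0 (fun _ => le_rfl) _ hp
      have hk' := hψ.2 _ hk
      rw [show resExp P n y z 0 = 0 by ext; rfl, map_sub, map_smul_field] at hk'
      exact exCoeff_zero_of_mem_cleanL K P n y w _
        ((Submodule.sub_mem_iff_left _ (Submodule.smul_mem _ k h1)).1 hk')
    · exact exCoeff_zero_of_mem_exGrade K P n y w _ hd _ (hψ.1 _ _ hp)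

theorem isClean_of_isClean_comp (hy : AtomEnum P n y) (x z w : P)
    (φ : ExMod K P n y x →ₗ[FaceS K P] ExMod K P n y z)
    (ψ : ExMod K P n y z →ₗ[FaceS K P] ExMod K P n y w)
    (hφ0 : DegZero K P n y x z φ) (hψ : IsClean K P n y z w ψ)
    (hψφ : IsClean K P n y x w (ψ.comp φ)) (hne : ψ ≠ 0) : IsClean K P n y x z φ := by
  refine ⟨hφ0, fun e he => ?_⟩
  by_cases hφ : φ = 0
  · rw [hφ, LinearMap.zero_apply]
    exact zero_mem _
  have hzx := atom_le_of_ne_zero K P n y hy x z φ hφ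
  induction he using Submodule.span_induction with
  | mem e he =>
    obtain ⟨a, b, hb, hd, rfl⟩ := he
    set d := gdeg P n y x (mIdx P n y x a b) with hd_def
    let u : Fin n → ℕ := fun i => if y i ≤ z then (d i).toNat else 0
    have huz : ∀ i, u i ≠ 0 → y i ≤ z := fun i hi => by
      by_contra h
      exact hi (if_neg h)
    have hux : ∀ i, u i ≠ 0 → y i ≤ x := fun i hi => hzx i (huz i hi)
    have hdeg : ∀ i, gdeg P n y x (mIdx P n y x (a - resExp P n y x fun i => u i) b) i =
        if y i ≤ z then 0 else d i := by
      intro i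
      have hadd : mIdx P n y x a b = (resExp P n y x (fun i => u i), 0) +
          mIdx P n y x (a - resExp P n y x fun i => u i) b := by simp [mIdx]
      have hi := congrFun (hd_def.trans (congrArg (gdeg P n y x) hadd)) i
      rw [gdeg_add, Pi.add_apply, gdeg_resExp] at hi
      have h0 := hd i
      by_cases hiz : y i ≤ z
      · rw [if_pos (hzx i hiz)] at hi
        simp only [u, if_pos hiz] at hi ⊢
        omega
      · simp only [u, if_neg hiz, Nat.cast_zero, ite_self, zero_add] at hi ⊢
        exact hi.symm
    have hdeg_nonneg : ∀ i, 0 ≤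
        gdeg P n y x (mIdx P n y x (a - resExp P n y x fun i => u i) b) i := by
      intro i
      rw [hdeg]
      split_ifs
      exacts [le_rfl, hd i]
    have he' := emono_mem_cleanL K P n y x _ b hb hdeg_nonneg
    obtain ⟨c, hc⟩ := exists_sub_smul_mem_cleanL K P n y z _ hdeg_nonneg _
      (hφ0 _ _ (mk_single_mem_exGrade K P n y x _ 1))
    have hres : resExp P n y z
        (gdeg P n y x (mIdx P n y x (a - resExp P n y x fun i => u i) b)) = 0 := by
      ext i
      rw [resExp_apply, hdeg, if_pos i.2, Finsupp.zero_apply]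
    rw [hres] at hc
    have hc0 : c = 0 := by
      by_contra hc0
      refine hne (eq_zero_of_isClean_of_map_onex_mem K P n y hy z w ψ hψ ?_)
      have h1 := hψ.2 _ hc
      rw [map_sub, map_smul_field] at h1
      exact (Submodule.smul_mem_iff _ hc0).1
        ((Submodule.sub_mem_iff_right _ (hψφ.2 _ he')).1 h1)
    rw [hc0, zero_smul, sub_zero] at hc
    have hfac := atomMono_smul_emono K P n y hy x u hux (a - resExp P n y x fun i => u i) b
    rw [add_sub_cancel] at hfac
    rw [← hfac, map_smul]
    exact atomMono_smul_mem_cleanL K P n y hy z u huz _ hc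
  | zero => rw [map_zero]; exact zero_mem _
  | add e f _ _ he hf => rw [map_add]; exact add_mem he hf
  | smul c e _ he => rw [map_smul_field]; exact Submodule.smul_mem _ c he

/-- Lemma 3.7: for degree preserving `φ : *E_x → *E_z` and
`ψ : *E_z → *E_w`: (1) if `φ` and `ψ` are clean then so is `ψ ∘ φ`;
(2) if `ψ` and `ψ ∘ φ` are clean and `ψ ≠ 0`, then `φ` is clean. -/
theorem statement13
    (hP : IsSimplicialPoset P) (hy : AtomEnum P n y) (x z w : P)
    (φ : ExMod K P n y x →ₗ[FaceS K P] ExMod K P n y z)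
    (ψ : ExMod K P n y z →ₗ[FaceS K P] ExMod K P n y w)
    (hφ0 : DegZero K P n y x z φ) (hψ0 : DegZero K P n y z w ψ) :
    (IsClean K P n y x z φ → IsClean K P n y z w ψ →
      IsClean K P n y x w (ψ.comp φ)) ∧
    (IsClean K P n y z w ψ → IsClean K P n y x w (ψ.comp φ) → ψ ≠ 0 →
      IsClean K P n y x z φ) := by
  refine ⟨fun hφ hψ => ⟨fun d e he => hψ0 d _ (hφ0 d e he), fun e he => hψ.2 _ (hφ.2 e he)⟩, ?_⟩
  exact isClean_of_isClean_comp K P n y hy x z w φ ψ hφ0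

end
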